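/- (Lemma 2.1(ii)) For every α ∈ [−1,1] and r ∈ [1,λ], the superposition operator Ξ_α^r : L^λ(μ) → L^r(μ) is globally Lipschitz continuous and satisfies a linear growth condition (there is a constant K with ‖Ξ_α^r(ã)‖_{L^r(μ)} ≤ K(1 + ‖ã‖_{L^λ(μ)}) for all ã); moreover, for every 1 ≤ i ≤ ⌈λ/r⌉−1, the supremum over ã ∈ L^λ(μ) of the operator norm ‖D^iΞ^r_{α,ã}‖ of the i-th Fréchet derivative is finite. -/

import Mathlib

open MeasureTheory Real Set NNReal
open scoped ENNReal

/-- A smooth real function that is bounded together with all of its derivatives. -/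
def IsBddSmooth (f : ℝ → ℝ) : Prop :=
  ∀ n : ℕ, Differentiable ℝ (iteratedDeriv n f) ∧ ∃ C : ℝ, ∀ x, |iteratedDeriv n f x| ≤ C

namespace IsBddSmooth

variable {f : ℝ → ℝ}

lemma differentiable (hf : IsBddSmooth f) : Differentiable ℝ f := by
  simpa using (hf 0).1

lemma exists_bound (hf : IsBddSmooth f) : ∃ C : ℝ, ∀ x, |f x| ≤ C := by
  simpa using (hf 0).2

lemma deriv (hf : IsBddSmooth f) : IsBddSmooth (deriv f) := fun n => by
  simpa only [iteratedDeriv_succ'] using hf (n + 1)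

/-- A set of bounded differentiable functions closed under differentiation consists of
smooth functions with bounded derivatives. -/
lemma of_mem {S : Set (ℝ → ℝ)} (hd : ∀ f ∈ S, Differentiable ℝ f)
    (hb : ∀ f ∈ S, ∃ C : ℝ, ∀ x, |f x| ≤ C) (hS : ∀ f ∈ S, _root_.deriv f ∈ S)
    (hf : f ∈ S) : IsBddSmooth f := by
  intro n
  have key : iteratedDeriv n f ∈ S := by
    induction n with
    | zero => simpa using hf
    | succ n ih => rw [iteratedDeriv_succ]; exact hS _ ih
  exact ⟨hd _ key, hb _ key⟩

end IsBddSmooth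

lemma abs_sub_le_of_abs_deriv_le {f : ℝ → ℝ} {C : ℝ} (hf : Differentiable ℝ f)
    (hC : ∀ x, |deriv f x| ≤ C) (x y : ℝ) : |f y - f x| ≤ C * |y - x| :=
  convex_univ.norm_image_sub_le_of_norm_deriv_le (fun z _ => hf z) (fun z _ => hC z)
    (mem_univ x) (mem_univ y)

/-- A bounded function with bounded derivative is Hölder continuous of every order in `(0, 1]`. -/
lemma IsBddSmooth.exists_holder {f : ℝ → ℝ} (hf : IsBddSmooth f) {q : ℝ} (hq : 0 < q)
    (hq1 : q ≤ 1) : ∃ K : ℝ, 0 ≤ K ∧ ∀ x y, |f y - f x| ≤ K * |y - x| ^ q := by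
  obtain ⟨C, hC⟩ := hf.exists_bound
  obtain ⟨D, hD⟩ := hf.deriv.exists_bound
  have hC0 : 0 ≤ C := (abs_nonneg _).trans (hC 0)
  have hD0 : 0 ≤ D := (abs_nonneg _).trans (hD 0)
  refine ⟨2 * C + D, by positivity, fun x y => ?_⟩
  have hpow : 0 ≤ |y - x| ^ q := by positivity
  rcases le_total |y - x| 1 with h | h
  · have h1 : |y - x| ≤ |y - x| ^ q := by
      simpa using rpow_le_rpow_of_exponent_ge_of_imp (abs_nonneg (y - x)) h hq1 (by simp)
    have h2 := abs_sub_le_of_abs_deriv_le hf.differentiable hD x y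
    nlinarith [mul_le_mul_of_nonneg_left h1 hD0, mul_nonneg hC0 hpow]
  · have h1 : 1 ≤ |y - x| ^ q := one_le_rpow h hq.le
    have h2 : |f y - f x| ≤ C + C := (abs_sub _ _).trans (add_le_add (hC y) (hC x))
    nlinarith [mul_nonneg hD0 hpow]

lemma abs_taylor_le {f : ℝ → ℝ} (hf : Differentiable ℝ f) {K q : ℝ} (hK : 0 ≤ K) (hq : 0 < q)
    (h : ∀ x y, |deriv f y - deriv f x| ≤ K * |y - x| ^ q) (x y : ℝ) :
    |f y - f x - deriv f x * (y - x)| ≤ K * |y - x| ^ (1 + q) := by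
  have hg : ∀ z, HasDerivAt (fun t => f t - deriv f x * t) (deriv f z - deriv f x) z := fun z => by
    simpa using (hf z).hasDerivAt.fun_sub ((hasDerivAt_id z).const_mul (deriv f x))
  have := (convex_uIcc x y).norm_image_sub_le_of_norm_hasDerivWithin_le
    (C := K * |y - x| ^ q) (fun z _ => (hg z).hasDerivWithinAt)
    (fun z hz => (h x z).trans (by
      have := abs_sub_left_of_mem_uIcc hz
      gcongr)) left_mem_uIcc right_mem_uIcc
  simp only [Real.norm_eq_abs] at this
  calc _ = |f y - deriv f x * y - (f x - deriv f x * x)| := by congr 1; ring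
    _ ≤ _ := this
    _ = _ := by
      rcases eq_or_ne y x with rfl | hne
      · simp [Real.zero_rpow (by positivity : 1 + q ≠ 0)]
      · rw [rpow_add (abs_pos.2 (sub_ne_zero.2 hne)), Real.rpow_one]; ring

section Superposition

variable {X : Type*} [MeasurableSpace X] {μ : Measure X}

open Classical in
/-- The superposition operator `a ↦ f ∘ a` from `L^p` to `L^r`, with value `0` at those `a` for
which `f ∘ a` is not in `L^r`. -/
noncomputable def superposition (μ : Measure X) (p r : ℝ≥0∞) (f : ℝ → ℝ) (a : Lp ℝ p μ) :
    Lp ℝ r μ :=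
  if h : MemLp (fun x => f (a x)) r μ then h.toLp _ else 0

lemma coeFn_superposition {p r : ℝ≥0∞} {f : ℝ → ℝ} {a : Lp ℝ p μ}
    (h : MemLp (fun x => f (a x)) r μ) : superposition μ p r f a =ᵐ[μ] fun x => f (a x) := by
  rw [superposition, dif_pos h]
  exact h.coeFn_toLp

/-- Pointwise multiplication `L^s → (L^p → L^r)` for Hölder exponents. -/
noncomputable def mulLp (μ : Measure X) (s p r : ℝ≥0∞) [ENNReal.HolderTriple s p r] [Fact (1 ≤ s)]
    [Fact (1 ≤ p)] [Fact (1 ≤ r)] : Lp ℝ s μ →L[ℝ] Lp ℝ p μ →L[ℝ] Lp ℝ r μ :=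
  (ContinuousLinearMap.mul ℝ ℝ).holderL μ s p r

lemma coeFn_mulLp (s p r : ℝ≥0∞) [ENNReal.HolderTriple s p r] [Fact (1 ≤ s)]
    [Fact (1 ≤ p)] [Fact (1 ≤ r)] (u : Lp ℝ s μ) (h : Lp ℝ p μ) :
    mulLp μ s p r u h =ᵐ[μ] fun x => u x * h x :=
  (ContinuousLinearMap.mul ℝ ℝ).coeFn_holder u h

variable [IsProbabilityMeasure μ]

lemma IsBddSmooth.memLp_comp {f : ℝ → ℝ} (hf : IsBddSmooth f) {p : ℝ≥0∞} (r : ℝ≥0∞)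
    (a : Lp ℝ p μ) : MemLp (fun x => f (a x)) r μ := by
  obtain ⟨C, hC⟩ := hf.exists_bound
  exact MemLp.of_bound (hf.differentiable.continuous.comp_aestronglyMeasurable
    (Lp.aestronglyMeasurable a)) C (ae_of_all _ fun x => hC (a x))

lemma memLp_comp_of_abs_deriv_le {f : ℝ → ℝ} {C : ℝ} (hf : Differentiable ℝ f)
    (hC : ∀ x, |deriv f x| ≤ C) {p r : ℝ≥0∞} (hrp : r ≤ p) (a : Lp ℝ p μ) :
    MemLp (fun x => f (a x)) r μ := by
  have h1 : MemLp ((fun _ => |f 0|) + fun x => C * ‖a x‖) r μ :=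
    (memLp_const |f 0|).add ((((Lp.memLp a).mono_exponent hrp).norm).const_mul C)
  refine h1.mono' (hf.continuous.comp_aestronglyMeasurable (Lp.aestronglyMeasurable a))
    (ae_of_all _ fun x => ?_)
  have := abs_sub_le_of_abs_deriv_le hf hC 0 (a x)
  rw [sub_zero] at this
  have h2 := abs_sub_abs_le_abs_sub (f (a x)) (f 0)
  rw [Real.norm_eq_abs, Pi.add_apply, Real.norm_eq_abs]
  linarith

/-- If `|u| ≤ C |h|^q` almost everywhere on a probability space and `r q ≤ p`, then
`‖u‖_r ≤ C ‖h‖_p^q`. -/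
lemma norm_le_mul_norm_rpow {p r : ℝ≥0∞} {q C : ℝ} (hC : 0 ≤ C) (hq : 0 < q)
    (hrp : r * ENNReal.ofReal q ≤ p) (u : Lp ℝ r μ) (h : Lp ℝ p μ)
    (huh : ∀ᵐ x ∂μ, |u x| ≤ C * |h x| ^ q) : ‖u‖ ≤ C * ‖h‖ ^ q := by
  have h1 : eLpNorm u r μ ≤ ENNReal.ofReal C * eLpNorm h p μ ^ q := by
    calc eLpNorm u r μ ≤ ENNReal.ofReal C * eLpNorm (fun x => ‖h x‖ ^ q) r μ := by
          refine eLpNorm_le_mul_eLpNorm_of_ae_le_mul ?_ r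
          filter_upwards [huh] with x hx
          rwa [Real.norm_of_nonneg (by positivity : 0 ≤ ‖h x‖ ^ q)]
      _ = ENNReal.ofReal C * eLpNorm h (r * ENNReal.ofReal q) μ ^ q := by
          rw [eLpNorm_norm_rpow _ hq]
      _ ≤ _ := by
          gcongr
          exact eLpNorm_le_eLpNorm_of_exponent_le hrp (Lp.aestronglyMeasurable h)
  have h2 := ENNReal.toReal_mono (ENNReal.mul_ne_top ENNReal.ofReal_ne_top
    (ENNReal.rpow_ne_top_of_nonneg hq.le (Lp.eLpNorm_ne_top h))) h1
  rwa [ENNReal.toReal_mul, ENNReal.toReal_ofReal hC, ← ENNReal.toReal_rpow] at h2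

lemma norm_superposition_sub_le {p r : ℝ≥0∞} {q C : ℝ} (hC : 0 ≤ C) (hq : 0 < q)
    (hrp : r * ENNReal.ofReal q ≤ p) {f : ℝ → ℝ}
    (hmem : ∀ a : Lp ℝ p μ, MemLp (fun x => f (a x)) r μ)
    (hf : ∀ x y, |f y - f x| ≤ C * |y - x| ^ q) (a b : Lp ℝ p μ) :
    ‖superposition μ p r f b - superposition μ p r f a‖ ≤ C * ‖b - a‖ ^ q := by
  refine norm_le_mul_norm_rpow hC hq hrp _ _ ?_
  filter_upwards [Lp.coeFn_sub (superposition μ p r f b) (superposition μ p r f a),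
    Lp.coeFn_sub b a, coeFn_superposition (hmem a), coeFn_superposition (hmem b)]
    with x h1 h2 h3 h4
  rw [h1, h2, Pi.sub_apply, Pi.sub_apply, h3, h4]
  exact hf _ _

variable {p : ℝ} [Fact (1 ≤ ENNReal.ofReal p)]

lemma ofReal_mul_ofReal_le {p r q : ℝ} (hr : 0 ≤ r) (h : r * q ≤ p) :
    ENNReal.ofReal r * ENNReal.ofReal q ≤ ENNReal.ofReal p := by
  rw [← ENNReal.ofReal_mul hr]
  exact ENNReal.ofReal_le_ofReal h

lemma one_le_of_fact (r : ℝ) [h : Fact (1 ≤ ENNReal.ofReal r)] : 1 ≤ r :=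
  ENNReal.one_le_ofReal.1 h.out

lemma IsBddSmooth.continuous_superposition {f : ℝ → ℝ} (hf : IsBddSmooth f) (r : ℝ)
    [Fact (1 ≤ ENNReal.ofReal r)] :
    Continuous (superposition μ (ENNReal.ofReal p) (ENNReal.ofReal r) f) := by
  have hp := one_le_of_fact p
  have hr := one_le_of_fact r
  obtain ⟨K, hK, hKf⟩ := hf.exists_holder (q := min 1 (p / r)) (by positivity) (min_le_left _ _)
  have hq : 0 < min 1 (p / r) := by positivity
  have hrp : r * min 1 (p / r) ≤ p := by
    calc r * min 1 (p / r) ≤ r * (p / r) := by gcongr; exact min_le_right _ _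
      _ = p := by field_simp
  rw [continuous_iff_continuousAt]
  intro a
  rw [ContinuousAt, tendsto_iff_norm_sub_tendsto_zero]
  refine squeeze_zero (fun _ => norm_nonneg _) (fun b => norm_superposition_sub_le hK hq
    (ofReal_mul_ofReal_le (by positivity) hrp) (hf.memLp_comp _) hKf a b) ?_
  have : Continuous fun b : Lp ℝ (ENNReal.ofReal p) μ => K * ‖b - a‖ ^ min 1 (p / r) :=
    continuous_const.mul (Continuous.rpow_const (by fun_prop) fun _ => Or.inr hq.le)
  simpa [Real.zero_rpow hq.ne'] using this.tendsto a

lemma IsBddSmooth.exists_norm_superposition_le {f : ℝ → ℝ} (hf : IsBddSmooth f) (p r : ℝ≥0∞)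
    [Fact (1 ≤ r)] : ∃ C : ℝ, ∀ a : Lp ℝ p μ, ‖superposition μ p r f a‖ ≤ C := by
  obtain ⟨C, hC⟩ := hf.exists_bound
  have hC0 : 0 ≤ C := (abs_nonneg _).trans (hC 0)
  refine ⟨C, fun a => ?_⟩
  have := Lp.norm_le_of_ae_bound (p := r) (f := superposition μ p r f a) hC0 (by
    filter_upwards [coeFn_superposition (hf.memLp_comp r a)] with x hx
    rw [hx]
    exact hC _)
  simpa [measureUnivNNReal] using this

lemma hasFDerivAt_superposition {f : ℝ → ℝ} (hf : Differentiable ℝ f)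
    (hf' : IsBddSmooth (deriv f)) {r s : ℝ} [Fact (1 ≤ ENNReal.ofReal r)]
    [Fact (1 ≤ ENNReal.ofReal s)] (hrp : r < p)
    [ENNReal.HolderTriple (ENNReal.ofReal s) (ENNReal.ofReal p) (ENNReal.ofReal r)]
    (a : Lp ℝ (ENNReal.ofReal p) μ) :
    HasFDerivAt (superposition μ (ENNReal.ofReal p) (ENNReal.ofReal r) f)
      (mulLp μ (ENNReal.ofReal s) (ENNReal.ofReal p) (ENNReal.ofReal r)
        (superposition μ (ENNReal.ofReal p) (ENNReal.ofReal s) (deriv f) a)) a := by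
  have hr := one_le_of_fact r
  obtain ⟨C, hC⟩ := hf'.exists_bound
  have hmem : ∀ b : Lp ℝ (ENNReal.ofReal p) μ, MemLp (fun x => f (b x)) (ENNReal.ofReal r) μ :=
    fun b => memLp_comp_of_abs_deriv_le hf hC (ENNReal.ofReal_le_ofReal hrp.le) b
  set q := min 1 (p / r - 1)
  have hq : 0 < q := lt_min one_pos (by rw [sub_pos, one_lt_div (by positivity)]; exact hrp)
  obtain ⟨K, hK, hKf⟩ := hf'.exists_holder hq (min_le_left _ _)
  have hrq : r * (1 + q) ≤ p := by
    calc r * (1 + q) ≤ r * (1 + (p / r - 1)) := by gcongr; exact min_le_right _ _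
      _ = p := by field_simp; ring
  rw [hasFDerivAt_iff_isLittleO_nhds_zero]
  have hO : (fun h : Lp ℝ (ENNReal.ofReal p) μ =>
      superposition μ (ENNReal.ofReal p) (ENNReal.ofReal r) f (a + h)
        - superposition μ (ENNReal.ofReal p) (ENNReal.ofReal r) f a
        - mulLp μ (ENNReal.ofReal s) (ENNReal.ofReal p) (ENNReal.ofReal r)
          (superposition μ (ENNReal.ofReal p) (ENNReal.ofReal s) (deriv f) a) h)
      =O[nhds 0] fun h => ‖h‖ ^ (1 + q) := by
    refine Asymptotics.IsBigO.of_bound K (Filter.Eventually.of_forall fun h => ?_)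
    rw [Real.norm_of_nonneg (by positivity : 0 ≤ ‖h‖ ^ (1 + q))]
    refine norm_le_mul_norm_rpow hK (by positivity) (ofReal_mul_ofReal_le (by positivity) hrq)
      _ _ ?_
    filter_upwards [Lp.coeFn_sub (superposition μ _ (ENNReal.ofReal r) f (a + h)
        - superposition μ _ (ENNReal.ofReal r) f a)
        (mulLp μ (ENNReal.ofReal s) (ENNReal.ofReal p) (ENNReal.ofReal r)
          (superposition μ (ENNReal.ofReal p) (ENNReal.ofReal s) (deriv f) a) h),
      Lp.coeFn_sub (superposition μ _ (ENNReal.ofReal r) f (a + h))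
        (superposition μ _ (ENNReal.ofReal r) f a),
      Lp.coeFn_add a h, coeFn_superposition (hmem a), coeFn_superposition (hmem (a + h)),
      coeFn_mulLp (ENNReal.ofReal s) (ENNReal.ofReal p) (ENNReal.ofReal r)
        (superposition μ (ENNReal.ofReal p) (ENNReal.ofReal s) (deriv f) a) h,
      coeFn_superposition (hf'.memLp_comp (ENNReal.ofReal s) a)] with x h1 h2 h3 h4 h5 h6 h7
    rw [h1, Pi.sub_apply, h2, Pi.sub_apply, h4, h5, h6, h7, h3, Pi.add_apply]
    simpa using abs_taylor_le hf hK hq hKf (a x) (a x + h x)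
  refine hO.trans_isLittleO ?_
  have ht : Filter.Tendsto (fun h : Lp ℝ (ENNReal.ofReal p) μ => ‖h‖ ^ q) (nhds 0) (nhds 0) := by
    have : Continuous fun h : Lp ℝ (ENNReal.ofReal p) μ => ‖h‖ ^ q :=
      Continuous.rpow_const continuous_norm fun _ => Or.inr hq.le
    simpa [Real.zero_rpow hq.ne'] using this.tendsto 0
  have hmul := (Asymptotics.isBigO_refl (fun h : Lp ℝ (ENNReal.ofReal p) μ => ‖h‖)
    (nhds 0)).mul_isLittleO ((Asymptotics.isLittleO_one_iff ℝ).2 ht)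
  refine Asymptotics.IsLittleO.of_norm_right (hmul.congr (fun h => ?_) fun h => mul_one _)
  rw [Real.rpow_add_of_nonneg (norm_nonneg h) zero_le_one hq.le, Real.rpow_one]

/-- Regularity of a superposition operator follows from regularity of that of the derivative. -/
lemma contDiff_superposition_succ {f : ℝ → ℝ} (hf : Differentiable ℝ f)
    (hf' : IsBddSmooth (deriv f)) {r : ℝ} [Fact (1 ≤ ENNReal.ofReal r)] (k : ℕ)
    (hk : (k + 1 : ℝ) * r < p)
    (ih : ∀ (s : ℝ) [Fact (1 ≤ ENNReal.ofReal s)], k * s < p →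
      ContDiff ℝ k (superposition μ (ENNReal.ofReal p) (ENNReal.ofReal s) (deriv f)) ∧
      ∀ i ≤ k, ∃ C : ℝ, ∀ a, ‖iteratedFDeriv ℝ i
        (superposition μ (ENNReal.ofReal p) (ENNReal.ofReal s) (deriv f)) a‖ ≤ C) :
    ContDiff ℝ (k + 1 : ℕ) (superposition μ (ENNReal.ofReal p) (ENNReal.ofReal r) f) ∧
      ∀ i ≤ k, ∃ C : ℝ, ∀ a, ‖iteratedFDeriv ℝ (i + 1)
        (superposition μ (ENNReal.ofReal p) (ENNReal.ofReal r) f) a‖ ≤ C := by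
  have hr := one_le_of_fact r
  have hrp : r < p := by nlinarith [mul_nonneg (Nat.cast_nonneg (α := ℝ) k) (by positivity : 0 ≤ r)]
  have hpr : 0 < p - r := sub_pos.2 hrp
  have hp : 0 < p := by linarith
  set s := p * r / (p - r) with hs
  have hs1 : 1 ≤ s := by
    rw [hs, one_le_div hpr]
    nlinarith
  have : Fact (1 ≤ ENNReal.ofReal s) := ⟨ENNReal.one_le_ofReal.2 hs1⟩
  have : ENNReal.HolderTriple (ENNReal.ofReal s) (ENNReal.ofReal p) (ENNReal.ofReal r) := by
    apply Real.HolderTriple.ennrealOfReal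
    refine ⟨?_, by positivity, hp⟩
    rw [hs]
    field_simp
    ring
  have hks : k * s < p := by
    rw [hs, ← mul_div_assoc, div_lt_iff₀ hpr]
    nlinarith
  obtain ⟨hcd, hbd⟩ := ih s hks
  have hd := hasFDerivAt_superposition (μ := μ) (s := s) hf hf' hrp
  have hfd : fderiv ℝ (superposition μ (ENNReal.ofReal p) (ENNReal.ofReal r) f)
      = mulLp μ (ENNReal.ofReal s) (ENNReal.ofReal p) (ENNReal.ofReal r) ∘
        superposition μ (ENNReal.ofReal p) (ENNReal.ofReal s) (deriv f) :=
    funext fun a => (hd a).fderiv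
  constructor
  · rw [Nat.cast_add, Nat.cast_one, contDiff_succ_iff_fderiv]
    refine ⟨fun a => (hd a).differentiableAt, by simp, ?_⟩
    rw [hfd]
    exact (ContinuousLinearMap.contDiff _).comp hcd
  · intro i hi
    obtain ⟨C, hC⟩ := hbd i hi
    refine ⟨‖mulLp μ (ENNReal.ofReal s) (ENNReal.ofReal p) (ENNReal.ofReal r)‖ * C, fun a => ?_⟩
    rw [← norm_iteratedFDeriv_fderiv, hfd]
    refine (ContinuousLinearMap.norm_iteratedFDeriv_comp_left _ hcd.contDiffAt
      (by exact_mod_cast hi)).trans ?_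
    gcongr
    exact hC a

/-- The superposition operator of a smooth function with bounded derivatives is of class `C^k`
from `L^p` to `L^r` with uniformly bounded derivatives whenever `k r < p`. -/
theorem IsBddSmooth.contDiff_superposition (k : ℕ) {f : ℝ → ℝ} (hf : IsBddSmooth f) (r : ℝ)
    [Fact (1 ≤ ENNReal.ofReal r)] (hk : k * r < p) :
    ContDiff ℝ k (superposition μ (ENNReal.ofReal p) (ENNReal.ofReal r) f) ∧
      ∀ i ≤ k, ∃ C : ℝ, ∀ a, ‖iteratedFDeriv ℝ i
        (superposition μ (ENNReal.ofReal p) (ENNReal.ofReal r) f) a‖ ≤ C := by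
  have h0 : ∃ C : ℝ, ∀ a, ‖iteratedFDeriv ℝ 0
      (superposition μ (ENNReal.ofReal p) (ENNReal.ofReal r) f) a‖ ≤ C := by
    simpa only [norm_iteratedFDeriv_zero] using
      hf.exists_norm_superposition_le (ENNReal.ofReal p) (ENNReal.ofReal r)
  induction k generalizing f r with
  | zero =>
    refine ⟨contDiff_zero.2 (hf.continuous_superposition r), fun i hi => ?_⟩
    obtain rfl : i = 0 := by omega
    exact h0
  | succ k ih =>
    have := contDiff_superposition_succ hf.differentiable hf.deriv k (by exact_mod_cast hk)
      (fun s _ hs => ih hf.deriv s hs (by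
        simpa only [norm_iteratedFDeriv_zero] using
          hf.deriv.exists_norm_superposition_le (ENNReal.ofReal p) (ENNReal.ofReal s)))
    refine ⟨this.1, fun i hi => ?_⟩
    cases i with
    | zero => exact h0
    | succ i => exact this.2 i (by omega)

end Superposition

section InverseFunction

variable {ψ : ℝ → ℝ}

lemma continuous_of_add_log_eq
    (hψ : ∀ z : ℝ, 0 < ψ z ∧ ψ z + Real.log (ψ z) = z) : Continuous ψ := by
  have key : ∀ a b, a ≤ b → ψ a ≤ ψ b ∧ ψ b - ψ a ≤ b - a := by
    intro a b hab
    have ha := hψ a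
    have hb := hψ b
    have h1 : ψ a ≤ ψ b := by
      by_contra! h
      have := log_lt_log hb.1 h
      linarith
    have := log_le_log ha.1 h1
    exact ⟨h1, by linarith⟩
  refine (LipschitzWith.of_le_add fun a b => ?_).continuous
  rw [Real.dist_eq]
  rcases le_total a b with h | h
  · linarith [(key a b h).1, abs_nonneg (a - b)]
  · linarith [(key b a h).2, le_abs_self (a - b)]

lemma hasDerivAt_of_add_log_eq
    (hψ : ∀ z : ℝ, 0 < ψ z ∧ ψ z + Real.log (ψ z) = z) (z : ℝ) :
    HasDerivAt ψ (1 - 1 / (1 + ψ z)) z := by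
  have hpos := (hψ z).1
  have h := HasDerivAt.of_local_left_inverse (f := fun y => y + log y) (g := ψ) (a := z)
    (continuous_of_add_log_eq hψ).continuousAt
    ((hasDerivAt_id (ψ z)).add (hasDerivAt_log hpos.ne')) (by positivity)
    (Filter.Eventually.of_forall fun y => (hψ y).2)
  convert! h using 1
  field_simp
  ring

lemma hasDerivAt_one_div_one_add
    (hψ : ∀ z : ℝ, 0 < ψ z ∧ ψ z + Real.log (ψ z) = z) (z : ℝ) :
    HasDerivAt (fun z => 1 / (1 + ψ z)) (-(1 / (1 + ψ z)) ^ 2 * (1 - 1 / (1 + ψ z))) z := by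
  have hpos := (hψ z).1
  have h := ((hasDerivAt_of_add_log_eq hψ z).const_add 1).inv (by positivity)
  simp only [one_div]
  convert! h using 1
  field_simp

lemma hasDerivAt_rpow_div_one_add
    (hψ : ∀ z : ℝ, 0 < ψ z ∧ ψ z + Real.log (ψ z) = z) (β z : ℝ) :
    HasDerivAt (fun z => ψ z ^ β / (1 + ψ z)) (ψ z ^ β / (1 + ψ z) *
      (β * (1 / (1 + ψ z)) - 1 / (1 + ψ z) + (1 / (1 + ψ z)) ^ 2)) z := by
  have hpos := (hψ z).1
  have h := ((hasDerivAt_of_add_log_eq hψ z).rpow_const (p := β) (Or.inl hpos.ne')).mul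
    (hasDerivAt_one_div_one_add hψ z)
  convert! h using 1
  · ext z
    simp [div_eq_mul_inv]
  · rw [rpow_sub_one hpos.ne']
    field_simp
    ring

lemma isBddSmooth_rpow_div_one_add
    (hψ : ∀ z : ℝ, 0 < ψ z ∧ ψ z + Real.log (ψ z) = z) {β : ℝ} (hβ : 0 ≤ β) (hβ1 : β ≤ 1) :
    IsBddSmooth (fun z => ψ z ^ β / (1 + ψ z)) := by
  have hder : ∀ (P : Polynomial ℝ) (z : ℝ),
      HasDerivAt (fun z => ψ z ^ β / (1 + ψ z) * P.eval (1 / (1 + ψ z)))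
        (ψ z ^ β / (1 + ψ z) * Polynomial.eval (1 / (1 + ψ z))
          (P * (Polynomial.C β * Polynomial.X - Polynomial.X + Polynomial.X ^ 2)
            - P.derivative * Polynomial.X ^ 2 * (1 - Polynomial.X))) z := by
    intro P z
    have h := (hasDerivAt_rpow_div_one_add hψ β z).mul
      ((P.hasDerivAt (1 / (1 + ψ z))).comp z (hasDerivAt_one_div_one_add hψ z))
    convert! h using 1
    simp
    ring
  refine IsBddSmooth.of_mem
    (S := range fun (P : Polynomial ℝ) z => ψ z ^ β / (1 + ψ z) * P.eval (1 / (1 + ψ z)))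
    ?_ ?_ ?_ ⟨1, by simp⟩
  · rintro _ ⟨P, rfl⟩ z
    exact (hder P z).differentiableAt
  · rintro _ ⟨P, rfl⟩
    obtain ⟨C, hC⟩ := (isCompact_Icc (a := (0 : ℝ)) (b := 1)).exists_bound_of_continuousOn
      P.continuous.continuousOn
    refine ⟨C, fun z => ?_⟩
    have hpos := (hψ z).1
    have hP := hC (1 / (1 + ψ z)) ⟨by positivity, by
      rw [div_le_one (by positivity)]; linarith⟩
    have hu0 : 0 ≤ ψ z ^ β / (1 + ψ z) := by positivity
    have hu1 : ψ z ^ β / (1 + ψ z) ≤ 1 := by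
      rw [div_le_one (by positivity)]
      calc ψ z ^ β ≤ (1 + ψ z) ^ β := by gcongr; linarith
        _ ≤ (1 + ψ z) ^ (1 : ℝ) := rpow_le_rpow_of_exponent_le (by linarith) hβ1
        _ = 1 + ψ z := Real.rpow_one _
    rw [abs_mul, abs_of_nonneg hu0]
    exact (mul_le_of_le_one_left (abs_nonneg _) hu1).trans hP
  · rintro _ ⟨P, rfl⟩
    exact ⟨_, (funext fun z => (hder P z).deriv).symm⟩

lemma hasDerivAt_alpha_coordinate
    (hψ : ∀ z : ℝ, 0 < ψ z ∧ ψ z + Real.log (ψ z) = z)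
    {α : ℝ} {ξ : ℝ → ℝ}
    (hξ : ∀ z : ℝ, ξ z = if α = 1 then z - ψ z else (2 / (1 - α)) * ψ z ^ ((1 - α) / 2)) (z : ℝ) :
    HasDerivAt ξ (ψ z ^ ((1 - α) / 2) / (1 + ψ z)) z := by
  have hpos := (hψ z).1
  rw [funext hξ]
  split_ifs with h
  · subst h
    convert! (hasDerivAt_id z).sub (hasDerivAt_of_add_log_eq hψ z) using 1
    simp
  · have h1 : 1 - α ≠ 0 := sub_ne_zero.2 (Ne.symm h)
    convert! ((hasDerivAt_of_add_log_eq hψ z).rpow_const (p := (1 - α) / 2)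
      (Or.inl hpos.ne')).const_mul (2 / (1 - α)) using 1
    rw [rpow_sub_one hpos.ne']
    field_simp
    ring

end InverseFunction

/-- Lemma 2.1(ii): the superposition operator `Ξ_α^r : L^λ(μ) → L^r(μ)` is
globally Lipschitz, satisfies a linear growth bound `‖Ξ_α^r(ã)‖ ≤ K(1 + ‖ã‖)`, is of class
`C^{⌈λ/r⌉−1}`, and for every `1 ≤ i ≤ ⌈λ/r⌉−1` the operator norms of its `i`-th Fréchet
derivatives are uniformly bounded over `L^λ(μ)`. -/
theorem stmt_4 {X : Type*} [MeasurableSpace X] (μ : Measure X) [IsProbabilityMeasure μ]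
    (lam r : ℝ) (hlam : 2 ≤ lam) (hr : 1 ≤ r) (hrlam : r ≤ lam)
    [Fact (1 ≤ ENNReal.ofReal lam)] [Fact (1 ≤ ENNReal.ofReal r)]
    (ψ : ℝ → ℝ) (hψ : ∀ z : ℝ, 0 < ψ z ∧ ψ z + Real.log (ψ z) = z)
    (α : ℝ) (hα : α ∈ Icc (-1 : ℝ) 1)
    (ξ : ℝ → ℝ)
    (hξ : ∀ z : ℝ, ξ z = if α = 1 then z - ψ z else (2 / (1 - α)) * ψ z ^ ((1 - α) / 2)) :
    ∃ Ξ : Lp ℝ (ENNReal.ofReal lam) μ → Lp ℝ (ENNReal.ofReal r) μ,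
      (∀ a : Lp ℝ (ENNReal.ofReal lam) μ, Ξ a =ᵐ[μ] fun x => ξ (a x)) ∧
      (∃ K : ℝ≥0, LipschitzWith K Ξ) ∧
      (∃ K : ℝ, ∀ a : Lp ℝ (ENNReal.ofReal lam) μ, ‖Ξ a‖ ≤ K * (1 + ‖a‖)) ∧
      ContDiff ℝ ((⌈lam / r⌉ - 1).toNat) Ξ ∧
      (∀ i : ℕ, 1 ≤ i → (i : ℤ) ≤ ⌈lam / r⌉ - 1 →
        ∃ C : ℝ, ∀ a : Lp ℝ (ENNReal.ofReal lam) μ, ‖iteratedFDeriv ℝ i Ξ a‖ ≤ C) := by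
  have hder := hasDerivAt_alpha_coordinate hψ hξ
  have hdiff : Differentiable ℝ ξ := fun z => (hder z).differentiableAt
  have hbs : IsBddSmooth (deriv ξ) := by
    rw [funext fun z => (hder z).deriv]
    exact isBddSmooth_rpow_div_one_add hψ (by linarith [hα.2]) (by linarith [hα.1])
  obtain ⟨C, hC⟩ := hbs.exists_bound
  have hC0 : 0 ≤ C := (abs_nonneg _).trans (hC 0)
  have hmem : ∀ a : Lp ℝ (ENNReal.ofReal lam) μ, MemLp (fun x => ξ (a x)) (ENNReal.ofReal r) μ :=
    fun a => memLp_comp_of_abs_deriv_le hdiff hC (ENNReal.ofReal_le_ofReal hrlam) a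
  have hsub : ∀ a b : Lp ℝ (ENNReal.ofReal lam) μ,
      ‖superposition μ (ENNReal.ofReal lam) (ENNReal.ofReal r) ξ b
        - superposition μ (ENNReal.ofReal lam) (ENNReal.ofReal r) ξ a‖ ≤ C * ‖b - a‖ := by
    intro a b
    simpa using norm_superposition_sub_le (q := 1) hC0 one_pos
      (by simpa using ENNReal.ofReal_le_ofReal hrlam) hmem
      (by simpa using abs_sub_le_of_abs_deriv_le hdiff hC) a b
  have hlip : LipschitzWith C.toNNReal
      (superposition μ (ENNReal.ofReal lam) (ENNReal.ofReal r) ξ) :=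
    LipschitzWith.of_dist_le_mul fun a b => by
      rw [dist_eq_norm, dist_eq_norm, Real.coe_toNNReal _ hC0]
      exact hsub b a
  have hreg : ∀ k : ℕ, ((k + 1 : ℕ) : ℤ) ≤ ⌈lam / r⌉ - 1 →
      ContDiff ℝ (k + 1 : ℕ) (superposition μ (ENNReal.ofReal lam) (ENNReal.ofReal r) ξ) ∧
      ∀ i ≤ k, ∃ C : ℝ, ∀ a, ‖iteratedFDeriv ℝ (i + 1)
        (superposition μ (ENNReal.ofReal lam) (ENNReal.ofReal r) ξ) a‖ ≤ C := by
    intro k hk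
    have hlt : ((k + 1 : ℕ) : ℤ) < ⌈lam / r⌉ := by omega
    rw [Int.lt_ceil, lt_div_iff₀ (by positivity)] at hlt
    exact contDiff_superposition_succ hdiff hbs k (by exact_mod_cast hlt)
      fun s _ hs => hbs.contDiff_superposition k s hs
  refine ⟨superposition μ (ENNReal.ofReal lam) (ENNReal.ofReal r) ξ,
    fun a => coeFn_superposition (hmem a), ⟨_, hlip⟩, ?_, ?_, ?_⟩
  · refine ⟨‖superposition μ (ENNReal.ofReal lam) (ENNReal.ofReal r) ξ 0‖ + C, fun a => ?_⟩
    have h1 := hsub 0 a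
    rw [sub_zero] at h1
    have h2 := norm_sub_norm_le (superposition μ (ENNReal.ofReal lam) (ENNReal.ofReal r) ξ a)
      (superposition μ (ENNReal.ofReal lam) (ENNReal.ofReal r) ξ 0)
    nlinarith [mul_nonneg (norm_nonneg
      (superposition μ (ENNReal.ofReal lam) (ENNReal.ofReal r) ξ 0)) (norm_nonneg a)]
  · rcases h : (⌈lam / r⌉ - 1).toNat with _ | k
    · exact contDiff_zero.2 hlip.continuous
    · exact (hreg k (by omega)).1
  · intro i hi hi'
    obtain ⟨k, rfl⟩ : ∃ k, i = k + 1 := ⟨i - 1, by omega⟩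
    exact (hreg k hi').2 k le_rfl
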